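/- Nonuniqueness for singular pencils (Corollary 1, necessity): Let D, M ∈ ℂ^{k×k} be such that det(sD − M) = 0 for every s ∈ ℂ. Then there exists an infinitely differentiable function ξ : ℝ → ℂ^k, not identically zero, with ξ(t) = 0 for all t ≤ 0 (in particular ξ(0) = 0) and D ξ'(t) = M ξ(t) for all t ∈ ℝ. Consequently, solutions of the initial value problem D ξ' = M ξ + f, ξ(0) given, are not unique when the pencil is singular. -/

import Mathlib

/-- Smooth functions vanishing on `(-∞, 0]`. -/
def causalSmooth : Submodule ℂ (ℝ → ℂ) where
  carrier := {f | ContDiff ℝ (⊤ : ℕ∞) f ∧ ∀ t ≤ (0:ℝ), f t = 0}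
  add_mem' := by
    rintro f g ⟨hf, hf0⟩ ⟨hg, hg0⟩
    exact ⟨hf.add hg, fun t ht => by simp [hf0 t ht, hg0 t ht]⟩
  zero_mem' := ⟨contDiff_const, fun t _ => rfl⟩
  smul_mem' := by
    rintro c f ⟨hf, hf0⟩
    exact ⟨contDiff_const.mul hf, fun t ht => by simp [hf0 t ht]⟩

lemma causalSmooth_diff (f : causalSmooth) : Differentiable ℝ f.1 :=
  f.2.1.differentiable (by simp)

lemma causalSmooth_deriv_mem (f : causalSmooth) : deriv f.1 ∈ causalSmooth := by
  refine ⟨(contDiff_infty_iff_deriv.1 f.2.1).2, fun t ht => ?_⟩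
  have h1 : HasDerivWithinAt f.1 (deriv f.1 t) (Set.Iic 0) t :=
    (causalSmooth_diff f t).hasDerivAt.hasDerivWithinAt
  have h2 : HasDerivWithinAt f.1 0 (Set.Iic 0) t :=
    (hasDerivWithinAt_const t (Set.Iic 0) (0:ℂ)).congr (fun x hx => f.2.2 x hx) (f.2.2 t ht)
  exact (uniqueDiffOn_Iic (0:ℝ) t ht).eq_deriv _ h1 h2

/-- Differentiation as an endomorphism. -/
noncomputable def causalD : Module.End ℂ causalSmooth where
  toFun f := ⟨deriv f.1, causalSmooth_deriv_mem f⟩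
  map_add' f g := by
    apply Subtype.ext
    funext t
    exact deriv_add (causalSmooth_diff f t) (causalSmooth_diff g t)
  map_smul' c f := by
    apply Subtype.ext
    funext t
    exact deriv_const_mul c (causalSmooth_diff f t)

lemma causalD_sub_inj (a : ℂ) (f : causalSmooth) (h : causalD f = a • f) : f = 0 := by
  have hd : ∀ t, deriv f.1 t = a * f.1 t := fun t => congrFun (congrArg Subtype.val h) t
  have hD : ∀ t : ℝ, HasDerivAt (fun t : ℝ => Complex.exp (-a * t) * f.1 t) 0 t := by
    intro t
    have h1 : HasDerivAt (fun t : ℝ => Complex.exp (-a * t))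
        (Complex.exp (-a * t) * (-a * 1)) t :=
      ((Complex.ofRealCLM.hasDerivAt (x := t)).const_mul (-a)).cexp
    have h2 := (causalSmooth_diff f t).hasDerivAt
    rw [hd] at h2
    exact (h1.mul h2).congr_deriv (by ring)
  apply Subtype.ext
  funext t
  have := is_const_of_deriv_eq_zero (fun t => (hD t).differentiableAt) (fun t => (hD t).deriv) t 0
  simpa [f.2.2 0 le_rfl, Complex.exp_ne_zero] using this

open Polynomial in
lemma causal_aeval_inj (n : ℕ) : ∀ p : ℂ[X], p.natDegree = n → p ≠ 0 → ∀ f : causalSmooth,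
    aeval causalD p f = 0 → f = 0 := by
  induction n with
  | zero =>
    intro p hp h0 f hf
    rw [eq_C_of_natDegree_eq_zero hp] at hf h0
    rw [aeval_C, Module.algebraMap_end_apply] at hf
    exact (smul_eq_zero.1 hf).resolve_left (by simpa using h0)
  | succ n ih =>
    intro p hp h0 f hf
    obtain ⟨a, ha⟩ := IsAlgClosed.exists_root p
      (by rw [degree_eq_natDegree h0, hp]; exact_mod_cast Nat.succ_ne_zero n)
    obtain ⟨q, rfl⟩ := dvd_iff_isRoot.2 ha
    have hq : q ≠ 0 := right_ne_zero_of_mul h0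
    rw [natDegree_mul (X_sub_C_ne_zero a) hq, natDegree_X_sub_C] at hp
    refine ih q (by omega) hq f ?_
    apply causalD_sub_inj a
    rw [map_mul, Module.End.mul_apply] at hf
    simpa [sub_eq_zero] using hf

/-- A nonzero element. -/
noncomputable def causalPhi : causalSmooth :=
  ⟨fun t => (expNegInvGlue t : ℂ),
    Complex.ofRealCLM.contDiff.comp expNegInvGlue.contDiff,
    fun t ht => by simp [expNegInvGlue.zero_of_nonpos ht]⟩

lemma causalPhi_ne : causalPhi ≠ 0 := by
  intro h
  have := congrFun (congrArg Subtype.val h) 1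
  have h1 := expNegInvGlue.pos_of_pos one_pos
  simp [causalPhi] at this
  linarith

/-- **nonuniqueness for singular pencils.** If
`det (s • D - M) = 0` for every `s ∈ ℂ`, then there is a smooth
`ξ : ℝ → ℂ^k`, not identically zero, vanishing on `(-∞, 0]`, with
`D ξ'(t) = M ξ(t)` for all `t`; hence solutions of the initial value problem
`D ξ' = M ξ + f` are not unique. -/
theorem singular_pencil_nonuniqueness
    {k : ℕ} (D M : Matrix (Fin k) (Fin k) ℂ)
    (hsing : ∀ s : ℂ, (s • D - M).det = 0) :
    ∃ ξ : ℝ → (Fin k → ℂ),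
      ContDiff ℝ (⊤ : ℕ∞) ξ ∧
      (¬ ∀ t : ℝ, ξ t = 0) ∧
      (∀ t ≤ (0:ℝ), ξ t = 0) ∧
      ∀ t : ℝ, D.mulVec (deriv ξ t) = M.mulVec (ξ t) := by
  classical
  let A : Matrix (Fin k) (Fin k) (Polynomial ℂ) :=
    Matrix.of fun i j => Polynomial.X * Polynomial.C (D i j) - Polynomial.C (M i j)
  have hA : A.det = 0 := by
    apply Polynomial.funext
    intro s
    rw [← Polynomial.coe_evalRingHom, RingHom.map_det, map_zero, ← hsing s]
    congr 1
    ext i j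
    simp [A]
    ring
  obtain ⟨v, hv, hAv⟩ := Matrix.exists_mulVec_eq_zero_iff.2 hA
  let g : Fin k → causalSmooth := fun i => Polynomial.aeval causalD (v i) causalPhi
  have hg : ∀ j, ∑ i, (D j i • causalD (g i) - M j i • g i) = 0 := by
    intro j
    have h := congrArg (fun p => Polynomial.aeval causalD p causalPhi) (congrFun hAv j)
    have e : (A.mulVec v) j =
        ∑ i, (Polynomial.C (D j i) * (Polynomial.X * v i) - Polynomial.C (M j i) * v i) := by
      simp only [Matrix.mulVec, dotProduct, A, Matrix.of_apply]
      exact Finset.sum_congr rfl fun i _ => by ring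
    rw [e] at h
    simp only [Pi.zero_apply, map_zero, LinearMap.zero_apply, map_sum, LinearMap.sum_apply,
      map_sub, LinearMap.sub_apply, map_mul, Module.End.mul_apply, Polynomial.aeval_C,
      Polynomial.aeval_X, Module.algebraMap_end_apply] at h
    exact h
  refine ⟨fun t i => (g i).1 t, contDiff_pi.2 fun i => (g i).2.1, ?_, ?_, ?_⟩
  · intro h
    obtain ⟨i, hi⟩ := Function.ne_iff.1 hv
    refine causalPhi_ne (causal_aeval_inj _ (v i) rfl hi _ (Subtype.ext (funext fun t => ?_)))
    exact congrFun (h t) i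
  · intro t ht
    funext i
    exact (g i).2.2 t ht
  · intro t
    rw [deriv_pi fun i => causalSmooth_diff (g i) t]
    funext j
    have h := congrFun (congrArg Subtype.val (hg j)) t
    rw [AddSubmonoidClass.coe_finsetSum, Finset.sum_apply] at h
    have h' : ∑ i, (D j i * deriv (g i).1 t - M j i * (g i).1 t) = 0 := h
    rw [Finset.sum_sub_distrib, sub_eq_zero] at h'
    exact h'
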